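/- arXiv:math/0406538 — 4 statements merged into one kernel-verified Lean document; each statement's English description precedes it below -/
import Mathlib

section
/- Let n be an odd positive integer and let S be a set of integers with S ⊆ {i : i odd, 0 < i < n/3} ∪ {i : i ≡ n (mod 4), 0 < i < n}. Let F(x) = x^n + Σ_{i∈S} x^i + 1 ∈ Z[x]. Then the discriminant of F satisfies disc(F) ≡ 1 (mod 8) if n ≡ ±1 (mod 8), and disc(F) ≡ 5 (mod 8) if n ≡ ±3 (mod 8). -/
open Polynomial

/-- The Sylvester matrix of `f` (of formal degree `n`) and `g` (of formal degree `m`):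
the first `m` rows contain the coefficients of `f` and the remaining `n` rows contain
the coefficients of `g`, as in van der Waerden. -/
noncomputable def sylvesterMatrix (n m : ℕ) (f g : Polynomial ℤ) :
    Matrix (Fin (m + n)) (Fin (m + n)) ℤ :=
  Matrix.of fun i j =>
    if (i : ℕ) < m then
      (if (i : ℕ) ≤ (j : ℕ) ∧ (j : ℕ) ≤ (i : ℕ) + n then f.coeff ((i : ℕ) + n - (j : ℕ))
       else 0)
    else
      (if (i : ℕ) - m ≤ (j : ℕ) ∧ (j : ℕ) ≤ (i : ℕ) then g.coeff ((i : ℕ) - (j : ℕ))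
       else 0)

/-- The resultant `R(f, g)` of `f` (formal degree `n`) and `g` (formal degree `m`),
defined as the determinant of the Sylvester matrix. -/
noncomputable def res (n m : ℕ) (f g : Polynomial ℤ) : ℤ := (sylvesterMatrix n m f g).det

/-- The discriminant of a monic polynomial `F` of degree `n`:
`disc F = (-1)^(n(n-1)/2) · R(F, F')`. -/
noncomputable def disc (n : ℕ) (F : Polynomial ℤ) : ℤ :=
  (-1) ^ (n * (n - 1) / 2) * res n (n - 1) F (Polynomial.derivative F)

/-- The power sums of `y` are determined recursively by the coefficients of `∏ (X - y i)`. -/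
lemma sum_pow_eq_of_prod_X_sub_C {σ R : Type*} [Fintype σ] [CommRing R] (y : σ → R)
    {P : R[X]} (hP : ∏ i, (X - C (y i)) = P) {k : ℕ} (hk : 0 < k) (hkn : k ≤ Fintype.card σ) :
    ∑ i, y i ^ k = -(k * P.coeff (Fintype.card σ - k)) -
      ∑ a ∈ Finset.HasAntidiagonal.antidiagonal k with a.1 ∈ Set.Ioo 0 k,
        P.coeff (Fintype.card σ - a.1) * ∑ i, y i ^ a.2 := by
  have hcoeff : ∀ j ≤ Fintype.card σ, P.coeff (Fintype.card σ - j) =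
      (-1) ^ j * MvPolynomial.aeval y (MvPolynomial.esymm σ R j) := by
    intro j hj
    have hcard : (Finset.univ.val.map y).card = Fintype.card σ := by simp
    have h := Multiset.prod_X_sub_C_coeff (Finset.univ.val.map y) (k := Fintype.card σ - j)
      (by rw [hcard]; omega)
    rw [Multiset.map_map, hcard, Nat.sub_sub_self hj] at h
    rw [MvPolynomial.aeval_esymm_eq_multiset_esymm, ← h, ← hP]
    rfl
  have hpsum : ∀ j, MvPolynomial.aeval y (MvPolynomial.psum σ R j) = ∑ i, y i ^ j := by
    intro j
    simp [MvPolynomial.psum]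
  have h := congrArg (MvPolynomial.aeval y) (MvPolynomial.psum_eq_mul_esymm_sub_sum σ R k hk)
  simp only [map_sub, map_mul, map_pow, map_neg, map_one, map_natCast, map_sum, hpsum] at h
  rw [h, hcoeff k hkn]
  congr 1
  · ring
  · refine Finset.sum_congr rfl fun a ha => ?_
    simp only [Finset.mem_filter, Finset.HasAntidiagonal.mem_antidiagonal, Set.mem_Ioo] at ha
    rw [hcoeff a.1 (by omega)]

/-- Expansion of `∏ (u + 2 y i)` modulo `8`, the second elementary symmetric function being
expressed through power sums. -/
lemma exists_sq_mul_prod_add_two_mul {σ R : Type*} [CommRing R] (s : Finset σ) (y : σ → R)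
    (u : R) : ∃ e c : R, 2 * e = (∑ i ∈ s, y i) ^ 2 - ∑ i ∈ s, y i ^ 2 ∧
      u ^ 2 * ∏ i ∈ s, (u + 2 * y i) =
        u ^ s.card * (u ^ 2 + 2 * u * ∑ i ∈ s, y i + 4 * e) + 8 * c := by
  classical
  induction s using Finset.induction_on with
  | empty => exact ⟨0, 0, by simp, by simp⟩
  | insert a s ha ih =>
    obtain ⟨e, c, he, hc⟩ := ih
    refine ⟨e + y a * ∑ i ∈ s, y i, u ^ s.card * e * y a + c * (u + 2 * y a), ?_, ?_⟩
    · rw [Finset.sum_insert ha, Finset.sum_insert ha]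
      linear_combination he
    · rw [Finset.sum_insert ha, Finset.prod_insert ha, Finset.card_insert_of_notMem ha]
      linear_combination (u + 2 * y a) * hc

section PowerSums

variable {R : Type*} [CommRing R] {n : ℕ} {S : Finset ℕ} {y : Fin n → R}

lemma coeff_X_pow_add_sum_add_one (S : Finset ℕ) {n k : ℕ} (hk : 0 < k) (hkn : k < n) :
    (X ^ n + (∑ i ∈ S, X ^ i) + 1 : R[X]).coeff k = if k ∈ S then 1 else 0 := by
  simp [coeff_X_pow, coeff_one, hk.ne', hkn.ne]

lemma sum_pow_eq_zero_of_odd (hn : Odd n) (hS : ∀ i ∈ S, Odd i)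
    (hy : ∏ i, (X - C (y i)) = X ^ n + (∑ i ∈ S, X ^ i) + 1) {k : ℕ} (hk : Odd k)
    (hkn : k < n) : ∑ i, y i ^ k = 0 := by
  induction k using Nat.strong_induction_on with
  | _ k ih =>
    have hk0 := hk.pos
    rw [sum_pow_eq_of_prod_X_sub_C y hy hk0 (by simpa using hkn.le), Fintype.card_fin,
      coeff_X_pow_add_sum_add_one S (by omega) (by omega), if_neg, mul_zero, neg_zero, zero_sub,
      neg_eq_zero]
    · refine Finset.sum_eq_zero fun a ha => ?_
      simp only [Finset.mem_filter, Finset.HasAntidiagonal.mem_antidiagonal, Set.mem_Ioo] at ha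
      rw [coeff_X_pow_add_sum_add_one S (by omega) (by omega)]
      split_ifs with h
      · have := hS _ h
        rw [ih a.2 (by omega) (by grind) (by omega), mul_zero]
      · exact zero_mul _
    · intro h
      have := hS _ h
      grind

lemma four_dvd_sum_pow
    (hS : ∀ i ∈ S, n < 3 * i → i % 4 = n % 4)
    (hy : ∏ i, (X - C (y i)) = X ^ n + (∑ i ∈ S, X ^ i) + 1) {k : ℕ} (hk : 0 < k)
    (hkn : 3 * k < 2 * n) : 4 ∣ ∑ i, y i ^ k := by
  induction k using Nat.strong_induction_on with
  | _ k ih =>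
    rw [sum_pow_eq_of_prod_X_sub_C y hy hk (by rw [Fintype.card_fin]; omega), Fintype.card_fin]
    refine dvd_sub ((dvd_neg).2 ?_) (Finset.dvd_sum fun a ha => ?_)
    · rw [coeff_X_pow_add_sum_add_one S (by omega) (by omega)]
      split_ifs with h
      · have := hS _ h (by omega)
        obtain ⟨m, rfl⟩ : 4 ∣ k := by omega
        exact ⟨m, by push_cast; ring⟩
      · simp
    · simp only [Finset.mem_filter, Finset.HasAntidiagonal.mem_antidiagonal, Set.mem_Ioo] at ha
      exact (ih a.2 (by omega) (by omega) (by omega)).mul_left _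

lemma sum_sum_mul_pow {ι : Type*} (s : Finset ι) (y : ι → R) (S : Finset ℕ) (g : ℕ → R) :
    ∑ j ∈ s, ∑ i ∈ S, g i * y j ^ i = ∑ i ∈ S, g i * ∑ j ∈ s, y j ^ i := by
  rw [Finset.sum_comm]
  simp_rw [Finset.mul_sum]

lemma four_dvd_sum_sq
    (hS : ∀ i ∈ S, (0 < i ∧ 3 * i < n) ∨ i % 4 = n % 4 ∧ 0 < i ∧ i < n)
    (hy : ∏ i, (X - C (y i)) = X ^ n + (∑ i ∈ S, X ^ i) + 1) :
    4 ∣ ∑ j, (∑ i ∈ S, (((n - i) / 2 : ℕ) : R) * y j ^ i) ^ 2 := by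
  set h : ℕ → R := fun i => (((n - i) / 2 % 2 : ℕ) : R) with hh
  set k : ℕ → R := fun i => (((n - i) / 2 / 2 : ℕ) : R) with hk
  have hg : ∀ i, (((n - i) / 2 : ℕ) : R) = h i + 2 * k i := by
    intro i
    have := Nat.mod_add_div ((n - i) / 2) 2
    simp only [hh, hk]
    exact_mod_cast congrArg (Nat.cast (R := R)) this.symm
  have hsq : ∀ j, (∑ i ∈ S, (((n - i) / 2 : ℕ) : R) * y j ^ i) ^ 2 =
      (∑ i ∈ S, ∑ l ∈ S, h i * h l * y j ^ (i + l)) +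
        4 * ((∑ i ∈ S, h i * y j ^ i) * (∑ i ∈ S, k i * y j ^ i) +
          (∑ i ∈ S, k i * y j ^ i) ^ 2) := by
    intro j
    have h1 : ∑ i ∈ S, (((n - i) / 2 : ℕ) : R) * y j ^ i =
        (∑ i ∈ S, h i * y j ^ i) + 2 * ∑ i ∈ S, k i * y j ^ i := by
      rw [Finset.mul_sum, ← Finset.sum_add_distrib]
      exact Finset.sum_congr rfl fun i _ => by rw [hg]; ring
    have h2 : ∑ i ∈ S, ∑ l ∈ S, h i * h l * y j ^ (i + l) = (∑ i ∈ S, h i * y j ^ i) ^ 2 := by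
      rw [sq, Finset.sum_mul_sum]
      exact Finset.sum_congr rfl fun i _ => Finset.sum_congr rfl fun l _ => by ring
    rw [h1, h2]
    ring
  simp_rw [hsq, Finset.sum_add_distrib]
  refine dvd_add ?_ (Finset.dvd_sum fun j _ => dvd_mul_right _ _)
  rw [Finset.sum_comm]
  refine Finset.dvd_sum fun i hi => ?_
  rw [Finset.sum_comm]
  refine Finset.dvd_sum fun l hl => ?_
  rw [← Finset.mul_sum]
  have hzero : ∀ i ∈ S, ¬ 3 * i < n → h i = 0 := by
    intro i hi hin
    have : (n - i) / 2 % 2 = 0 := by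
      have := hS i hi
      omega
    simp [hh, this]
  by_cases hi3 : 3 * i < n
  · by_cases hl3 : 3 * l < n
    · have := hS i hi
      refine (four_dvd_sum_pow (fun m hm hnm => ?_) hy (by omega) (by omega)).mul_left _
      have := hS m hm
      omega
    · simp [hzero l hl hl3]
  · simp [hzero i hi hi3]

lemma eight_dvd_prod_add_two_mul_sub [IsDomain R] [CharZero R] (hn : Odd n)
    (hS : ∀ i ∈ S, (Odd i ∧ 0 < i ∧ 3 * i < n) ∨ (i % 4 = n % 4 ∧ 0 < i ∧ i < n))
    (hy : ∏ i, (X - C (y i)) = X ^ n + (∑ i ∈ S, X ^ i) + 1) :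
    8 ∣ ∏ j, ((n : R) + 2 * ∑ i ∈ S, (((n - i) / 2 : ℕ) : R) * y j ^ i) - n := by
  have hodd : ∀ i ∈ S, Odd i ∧ i < n := by
    intro i hi
    have := hS i hi
    rw [Nat.odd_iff] at *
    omega
  obtain ⟨e, c, he, hc⟩ := exists_sq_mul_prod_add_two_mul Finset.univ
    (fun j => ∑ i ∈ S, (((n - i) / 2 : ℕ) : R) * y j ^ i) (n : R)
  have hp1 : ∑ j, ∑ i ∈ S, (((n - i) / 2 : ℕ) : R) * y j ^ i = 0 := by
    rw [sum_sum_mul_pow]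
    refine Finset.sum_eq_zero fun i hi => ?_
    rw [sum_pow_eq_zero_of_odd hn (fun i hi => (hodd i hi).1) hy (hodd i hi).1 (hodd i hi).2,
      mul_zero]
  obtain ⟨t, ht⟩ := four_dvd_sum_sq
    (fun i hi => (hS i hi).imp_left fun h => h.2) hy
  have he' : e = -(2 * t) := by
    refine mul_left_cancel₀ (two_ne_zero (α := R)) ?_
    rw [he, hp1, ht]
    ring
  rw [hp1, he', Finset.card_univ, Fintype.card_fin] at hc
  obtain ⟨q, hq⟩ : ∃ q : ℕ, n ^ 2 = 1 + 8 * q := by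
    have := Nat.eight_dvd_sq_sub_one_of_odd hn
    obtain ⟨q, hq⟩ := this
    have := Nat.one_le_pow 2 n hn.pos
    exact ⟨q, by omega⟩
  obtain ⟨m, hm⟩ := hn
  have hq' : (n : R) ^ 2 = 1 + 8 * q := by exact_mod_cast congrArg (Nat.cast (R := R)) hq
  have hpow : ∃ d : R, (n : R) ^ n = n + 8 * d := by
    obtain ⟨d, hd⟩ : (8 : R) ∣ ((n : R) ^ 2) ^ m - 1 := by
      refine dvd_trans ⟨(q : R), ?_⟩ (sub_one_dvd_pow_sub_one _ m)
      rw [hq']; ring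
    refine ⟨d * n, ?_⟩
    have : (n : R) ^ n = ((n : R) ^ 2) ^ m * n := by
      rw [← pow_mul, ← pow_succ, ← hm]
    rw [this]
    linear_combination (n : R) * hd
  obtain ⟨d, hd⟩ := hpow
  set Q := ∏ j, ((n : R) + 2 * ∑ i ∈ S, (((n - i) / 2 : ℕ) : R) * y j ^ i)
  refine ⟨d + n ^ n * q - n ^ n * t + c - q * Q, ?_⟩
  linear_combination hc + (n ^ n - Q) * hq' + hd

/-- `∏ P'(y i) ≡ n` modulo `8`, where the `y i` are the roots of `P = X ^ n + ∑ X ^ i + 1`. -/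
lemma eight_dvd_prod_eval_derivative_sub [IsDomain R] [CharZero R] (hn : Odd n)
    (hS : ∀ i ∈ S, (Odd i ∧ 0 < i ∧ 3 * i < n) ∨ (i % 4 = n % 4 ∧ 0 < i ∧ i < n))
    (hy : ∏ i, (X - C (y i)) = X ^ n + (∑ i ∈ S, X ^ i) + 1) :
    8 ∣ ∏ j, (derivative (X ^ n + (∑ i ∈ S, X ^ i) + 1 : R[X])).eval (y j) - n := by
  have hodd : ∀ i ∈ S, Odd i ∧ i < n := by
    intro i hi
    have := hS i hi
    rw [Nat.odd_iff] at *
    omega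
  have hprod : ∏ j, y j = -1 := by
    have h := congrArg (eval 0) hy
    have hS0 : ∑ i ∈ S, (0 : R) ^ i = 0 :=
      Finset.sum_eq_zero fun i hi => zero_pow (hodd i hi).1.pos.ne'
    simp only [eval_prod, eval_sub, eval_X, eval_C, zero_sub, eval_add, eval_pow, eval_finsetSum,
      eval_one, zero_pow hn.pos.ne', hS0, Finset.prod_neg, Finset.card_univ,
      Fintype.card_fin, hn.neg_one_pow] at h
    linear_combination -h
  have hroot : ∀ j, y j ^ n + (∑ i ∈ S, y j ^ i) + 1 = 0 := by
    intro j
    have h := congrArg (eval (y j)) hy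
    rw [eval_prod, Finset.prod_eq_zero (Finset.mem_univ j) (by simp)] at h
    simpa [eval_finsetSum] using h.symm
  have hpow : ∀ (k : ℕ) (z : R), z * (k * z ^ (k - 1)) = k * z ^ k := by
    intro k z
    cases k with
    | zero => simp
    | succ k => rw [Nat.add_sub_cancel]; ring
  have hderiv : ∀ j, y j * (derivative (X ^ n + (∑ i ∈ S, X ^ i) + 1 : R[X])).eval (y j) =
      -(n + 2 * ∑ i ∈ S, (((n - i) / 2 : ℕ) : R) * y j ^ i) := by
    intro j
    have h1 : y j * (derivative (X ^ n + (∑ i ∈ S, X ^ i) + 1 : R[X])).eval (y j) =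
        n * y j ^ n + ∑ i ∈ S, i * y j ^ i := by
      simp only [derivative_add, derivative_X_pow, derivative_sum, derivative_one, add_zero,
        eval_add, eval_finsetSum, eval_mul, eval_C, eval_pow, eval_X, mul_add, Finset.mul_sum,
        hpow]
    have h2 : 2 * ∑ i ∈ S, (((n - i) / 2 : ℕ) : R) * y j ^ i =
        n * (∑ i ∈ S, y j ^ i) - ∑ i ∈ S, i * y j ^ i := by
      rw [Finset.mul_sum, Finset.mul_sum, ← Finset.sum_sub_distrib]
      refine Finset.sum_congr rfl fun i hi => ?_
      have h3 : 2 * ((n - i) / 2) + i = n := by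
        have := hodd i hi
        rw [Nat.odd_iff] at *
        omega
      have h4 : 2 * (((n - i) / 2 : ℕ) : R) + i = n := by exact_mod_cast congrArg Nat.cast h3
      linear_combination y j ^ i * h4
    rw [h1, h2]
    linear_combination (n : R) * hroot j
  have h := Finset.prod_congr (rfl : (Finset.univ : Finset (Fin n)) = _) fun j _ => hderiv j
  rw [Finset.prod_mul_distrib, hprod, Finset.prod_neg, Finset.card_univ, Fintype.card_fin,
    hn.neg_one_pow, neg_one_mul, neg_one_mul, neg_inj] at h
  rw [h]
  exact eight_dvd_prod_add_two_mul_sub hn hS hy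

end PowerSums

lemma res_eq_resultant (n m : ℕ) (f g : ℤ[X]) : res n m f g = resultant f g n m := by
  have h : (sylvesterMatrix n m f g).submatrix
      ((finCongr (add_comm n m)).trans Fin.revPerm) ((finCongr (add_comm n m)).trans Fin.revPerm) =
      (sylvester f g n m).transpose := by
    ext i j
    simp only [sylvesterMatrix, sylvester, Matrix.submatrix_apply, Matrix.of_apply,
      Matrix.transpose_apply, Equiv.trans_apply, Fin.revPerm_apply, finCongr_apply, Fin.val_rev,
      Fin.val_cast, Set.mem_Icc]
    induction i using Fin.addCases with
    | left i =>
      simp only [Fin.addCases_left, Fin.val_castAdd]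
      rw [if_neg (by omega)]
      have hi := i.2
      have hj := j.2
      split_ifs <;> first | omega | rfl | (congr 1; omega)
    | right i =>
      simp only [Fin.addCases_right, Fin.val_natAdd]
      rw [if_pos (by omega)]
      have hi := i.2
      have hj := j.2
      split_ifs <;> first | omega | rfl | (congr 1; omega)
  rw [res, resultant, ← Matrix.det_transpose (sylvester f g n m), ← h,
    Matrix.det_submatrix_equiv_self]

/-- A monic integer polynomial splits over the ring of all algebraic integers. -/
lemma exists_prod_X_sub_C_eq_map {F : ℤ[X]} (hF : F.Monic) :
    ∃ y : Fin F.natDegree → integralClosure ℤ ℂ,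
      ∏ i, (X - C (y i)) = F.map (algebraMap ℤ (integralClosure ℤ ℂ)) := by
  have hsplit := IsAlgClosed.splits (F.map (algebraMap ℤ ℂ))
  have hcard : (F.map (algebraMap ℤ ℂ)).roots.toList.length = F.natDegree := by
    rw [Multiset.length_toList, ← hsplit.natDegree_eq_card_roots, hF.natDegree_map]
  have hint : ∀ i : Fin F.natDegree,
      (F.map (algebraMap ℤ ℂ)).roots.toList.get (i.cast hcard.symm) ∈ integralClosure ℤ ℂ := by
    intro i
    have hmem := List.get_mem (F.map (algebraMap ℤ ℂ)).roots.toList (i.cast hcard.symm)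
    rw [Multiset.mem_toList, mem_roots (hF.map _).ne_zero, IsRoot.def, eval_map] at hmem
    exact ⟨F, hF, hmem⟩
  refine ⟨fun i => ⟨_, hint i⟩, ?_⟩
  apply map_injective (algebraMap (integralClosure ℤ ℂ) ℂ) Subtype.val_injective
  rw [map_map, ← IsScalarTower.algebraMap_eq, Polynomial.map_prod]
  simp only [Polynomial.map_sub, map_X, map_C]
  conv_rhs => rw [hsplit.eq_prod_roots_of_monic (hF.map _), ← Multiset.coe_toList (roots _)]
  rw [Multiset.map_coe, Multiset.prod_coe, ← List.prod_ofFn]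
  congr 1
  apply List.ext_get
  · rw [List.length_ofFn, List.length_map, hcard]
  · intro i h1 h2
    simp

lemma Int.dvd_of_algebraMap_dvd_integralClosure {a b : ℤ}
    (h : algebraMap ℤ (integralClosure ℤ ℂ) a ∣ algebraMap ℤ (integralClosure ℤ ℂ) b) :
    a ∣ b := by
  obtain ⟨r, hr⟩ := h
  have hr' : (b : ℂ) = a * (r : ℂ) := by
    simpa using congrArg (algebraMap (integralClosure ℤ ℂ) ℂ) hr
  by_cases ha : a = 0
  · subst ha
    have : b = 0 := by simpa using hr'
    simp [this]
  have hq : algebraMap ℚ ℂ (b / a) = r := by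
    have : (a : ℂ) ≠ 0 := by exact_mod_cast ha
    rw [map_div₀, map_intCast, map_intCast, hr']
    field_simp
  have hint : IsIntegral ℤ ((b : ℚ) / a) := by
    refine (isIntegral_algebraMap_iff (algebraMap ℚ ℂ).injective).1 ?_
    rw [hq]
    exact r.2
  obtain ⟨z, hz⟩ := IsIntegrallyClosed.isIntegral_iff.1 hint
  refine ⟨z, ?_⟩
  have ha' : (a : ℚ) ≠ 0 := by exact_mod_cast ha
  rw [eq_intCast, eq_div_iff ha'] at hz
  rw [mul_comm]
  exact_mod_cast hz.symm

lemma resultant_prod_X_sub_C {R : Type*} [CommRing R] [IsDomain R] {n m : ℕ} (y : Fin n → R)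
    (g : R[X]) (hg : g.natDegree ≤ m) :
    resultant (∏ i, (X - C (y i))) g n m = ∏ i, g.eval (y i) := by
  have hmonic : (∏ i, (X - C (y i))).Monic := monic_prod_of_monic _ _ fun i _ => monic_X_sub_C _
  have hdeg : (∏ i, (X - C (y i))).natDegree = n := by simp
  have h := resultant_eq_prod_eval (∏ i, (X - C (y i))) g m hg
    (Splits.prod fun i _ => Splits.X_sub_C _)
  have hroots : (∏ i, (X - C (y i))).roots = Finset.univ.val.map y := by
    rw [← roots_multiset_prod_X_sub_C (Finset.univ.val.map y), Multiset.map_map]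
    rfl
  rw [hdeg, hmonic.leadingCoeff, one_pow, one_mul, hroots, Multiset.map_map] at h
  exact h

theorem res_derivative_modEq_eight {n : ℕ} (hn : Odd n) {S : Finset ℕ}
    (hS : ∀ i ∈ S, (Odd i ∧ 0 < i ∧ 3 * i < n) ∨ (i % 4 = n % 4 ∧ 0 < i ∧ i < n))
    {F : ℤ[X]} (hF : F = X ^ n + (∑ i ∈ S, X ^ i) + 1) :
    res n (n - 1) F (derivative F) ≡ n [ZMOD 8] := by
  have hlow : ((∑ i ∈ S, X ^ i) + 1 : ℤ[X]).degree < n := by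
    refine (degree_add_le _ _).trans_lt (max_lt ?_ ?_)
    · refine (degree_sum_le _ _).trans_lt ((Finset.sup_lt_iff (WithBot.bot_lt_coe n)).2 ?_)
      intro i hi
      rw [degree_X_pow]
      have := hS i hi
      exact Nat.cast_lt.2 (by omega)
    · rw [degree_one]
      exact_mod_cast hn.pos
  rw [add_assoc] at hF
  have hmonic : F.Monic := hF ▸ monic_X_pow_add hlow
  have hdeg : F.natDegree = n := by
    rw [hF]
    exact natDegree_eq_of_degree_eq_some
      ((degree_add_eq_left_of_degree_lt (by rwa [degree_X_pow])).trans (degree_X_pow n))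
  obtain ⟨y, hy⟩ := exists_prod_X_sub_C_eq_map hmonic
  rw [← hdeg] at hn hS hF ⊢
  set φ := algebraMap ℤ (integralClosure ℤ ℂ)
  have hmap : F.map φ = X ^ F.natDegree + (∑ i ∈ S, X ^ i) + 1 := by
    conv_lhs => rw [hF]
    simp [Polynomial.map_sum, add_assoc]
  have h := eight_dvd_prod_eval_derivative_sub hn hS (hy.trans hmap)
  rw [← hmap, ← resultant_prod_X_sub_C y _ (m := F.natDegree - 1)
    ((natDegree_derivative_le _).trans (Nat.sub_le_sub_right natDegree_map_le 1)), hy,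
    derivative_map, resultant_map_map, ← res_eq_resultant] at h
  refine (Int.modEq_iff_dvd.2 (Int.dvd_of_algebraMap_dvd_integralClosure ?_)).symm
  simpa [φ] using h

/-- Let `n` be odd and `F = x^n + ∑_{i ∈ S} x^i + 1 ∈ ℤ[x]` where every `i ∈ S` is
either odd with `0 < i < n/3`, or satisfies `i ≡ n (mod 4)` with `0 < i < n`.  Then
`disc F ≡ 1 (mod 8)` if `n ≡ ±1 (mod 8)`, and `disc F ≡ 5 (mod 8)` if
`n ≡ ±3 (mod 8)`. -/
theorem disc_mod_eight (n : ℕ) (hodd : Odd n) (hpos : 0 < n)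
    (S : Finset ℕ)
    (hS : ∀ i ∈ S, (Odd i ∧ 0 < i ∧ 3 * i < n) ∨ (i % 4 = n % 4 ∧ 0 < i ∧ i < n))
    (F : Polynomial ℤ) (hF : F = X ^ n + (∑ i ∈ S, X ^ i) + 1) :
    ((n % 8 = 1 ∨ n % 8 = 7) → disc n F ≡ 1 [ZMOD 8]) ∧
    ((n % 8 = 3 ∨ n % 8 = 5) → disc n F ≡ 5 [ZMOD 8]) := by
  have h := res_derivative_modEq_eight hodd hS hF
  obtain ⟨m, rfl⟩ := hodd
  have hexp : (2 * m + 1) * (2 * m + 1 - 1) / 2 = (2 * m + 1) * m := by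
    rw [Nat.add_sub_cancel, mul_left_comm, Nat.mul_div_cancel_left _ two_pos]
  rw [disc, hexp, pow_mul, Odd.neg_one_pow ⟨m, rfl⟩]
  clear hexp
  simp only [Int.ModEq] at h ⊢
  rcases Nat.even_or_odd m with hm | hm
  · rw [hm.neg_one_pow]
    rw [Nat.even_iff] at hm
    omega
  · rw [hm.neg_one_pow]
    rw [Nat.odd_iff] at hm
    omega
end

section
/- Let f ∈ F_2[x] be a polynomial with no repeated roots, let t be the number of (monic) irreducible factors of f over F_2, and let F ∈ Z[x] be any monic polynomial whose reduction modulo 2 equals f. Then t ≡ deg(f) (mod 2) if and only if disc(F) ≡ 1 (mod 8). -/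
open Polynomial

/-- The pairs `(i, j)` with `i < j`. -/
def ltPairs (n : ℕ) : Finset (Fin n × Fin n) := Finset.univ.filter fun p => p.1 < p.2

@[to_additive]
theorem prod_ltPairs_perm {n : ℕ} {M : Type*} [CommMonoid M] (g : Fin n → Fin n → M)
    (hg : ∀ i j, g i j = g j i) (σ : Equiv.Perm (Fin n)) :
    ∏ p ∈ ltPairs n, g (σ p.1) (σ p.2) = ∏ p ∈ ltPairs n, g p.1 p.2 := by
  refine Finset.prod_bij' (fun p _ => (min (σ p.1) (σ p.2), max (σ p.1) (σ p.2)))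
    (fun p _ => (min (σ.symm p.1) (σ.symm p.2), max (σ.symm p.1) (σ.symm p.2))) ?_ ?_ ?_ ?_ ?_
  · rintro ⟨i, j⟩ h
    simp only [ltPairs, Finset.mem_filter, Finset.mem_univ, true_and] at h ⊢
    simpa using h.ne'
  · rintro ⟨i, j⟩ h
    simp only [ltPairs, Finset.mem_filter, Finset.mem_univ, true_and] at h ⊢
    simpa using h.ne'
  · rintro ⟨i, j⟩ h
    simp only [ltPairs, Finset.mem_filter, Finset.mem_univ, true_and] at h ⊢
    rcases le_total (σ i) (σ j) with h' | h' <;> simp [h', h.le]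
  · rintro ⟨i, j⟩ h
    simp only [ltPairs, Finset.mem_filter, Finset.mem_univ, true_and] at h ⊢
    rcases le_total (σ.symm i) (σ.symm j) with h' | h' <;> simp [h', h.le]
  · rintro ⟨i, j⟩ h
    dsimp only
    rcases le_total (σ i) (σ j) with h' | h'
    · simp [h']
    · simp [h', hg (σ i)]

@[to_additive]
theorem prod_ltPairs_eq_prod_prod {n : ℕ} {M : Type*} [CommMonoid M] (g : Fin n → Fin n → M) :
    ∏ p ∈ ltPairs n, g p.1 p.2 = ∏ i, ∏ j ∈ Finset.Ioi i, g i j := by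
  rw [Finset.prod_sigma']
  refine Finset.prod_bij' (fun p _ => ⟨p.1, p.2⟩) (fun p _ => (p.1, p.2)) ?_ ?_ ?_ ?_ ?_ <;>
    simp [ltPairs]

theorem sum_div_sq_eq_sign {K : Type*} [Field K] [CharP K 2] {n : ℕ} (x : Fin n → K)
    (hx : Function.Injective x) (σ : Equiv.Perm (Fin n)) (hσ : ∀ i, x (σ i) = x i ^ 2) :
    ∑ p ∈ ltPairs n, x p.1 * x p.2 / (x p.1 + x p.2) ^ 2 = 0 ↔ Equiv.Perm.sign σ = 1 := by
  have hne : ∀ i j, i ≠ j → x i + x j ≠ 0 := fun i j hij h =>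
    hij (hx (by rwa [CharTwo.add_eq_zero] at h))
  have h2 : (2 : K) = 0 := CharTwo.two_eq_zero
  let u : Fin n → Fin n → K := fun i j => x i / (x i + x j)
  let v : Fin n → Fin n → K := fun i j => if i < j then u i j else if j < i then u j i else 0
  let e : Fin n → Fin n → K := fun i j => if σ i < σ j then 0 else 1
  have hv : ∀ i j, v i j = v j i := by
    intro i j
    simp only [v]
    rcases lt_trichotomy i j with h | h | h <;> simp [h, h.not_gt]
  have hsum : ∑ p ∈ ltPairs n, x p.1 * x p.2 / (x p.1 + x p.2) ^ 2
      = ∑ p ∈ ltPairs n, e p.1 p.2 := by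
    have h1 : ∀ p ∈ ltPairs n, x p.1 * x p.2 / (x p.1 + x p.2) ^ 2
        = v (σ p.1) (σ p.2) - v p.1 p.2 + e p.1 p.2 := by
      rintro ⟨i, j⟩ h
      simp only [ltPairs, Finset.mem_filter, Finset.mem_univ, true_and] at h
      have hij := hne i j h.ne
      have hij' : x i ^ 2 + x j ^ 2 ≠ 0 := by
        rw [← CharTwo.add_sq]; exact pow_ne_zero 2 hij
      have hji' : x j ^ 2 + x i ^ 2 ≠ 0 := by rwa [add_comm]
      have hsq : (x i + x j) ^ 2 = x i ^ 2 + x j ^ 2 := CharTwo.add_sq _ _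
      rcases lt_or_gt_of_ne (σ.injective.ne h.ne) with h' | h'
      · simp only [v, e, u, h, h', if_true, hσ, hsq]
        field_simp
        linear_combination x i * x j ^ 2 * h2
      · simp only [v, e, u, h, h', h'.not_gt, if_true, if_false, hσ, hsq]
        field_simp
        linear_combination -(x i ^ 2 * x j ^ 3 + x j ^ 5) * h2
    rw [Finset.sum_congr rfl h1, Finset.sum_add_distrib, Finset.sum_sub_distrib,
      sum_ltPairs_perm v hv σ, sub_self, zero_add]
  rw [hsum]
  have hsign : Equiv.Perm.sign σ = (-1) ^ ((ltPairs n).filter fun p => ¬ σ p.1 < σ p.2).card := by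
    rw [σ.sign_eq_prod_prod_Ioi, ← prod_ltPairs_eq_prod_prod
      (fun i j => if σ i < σ j then (1 : ℤˣ) else -1), Finset.prod_ite]
    simp
  have hcount : ∑ p ∈ ltPairs n, e p.1 p.2
      = (((ltPairs n).filter fun p => ¬ σ p.1 < σ p.2).card : K) := by
    simp only [e]
    rw [Finset.sum_ite]
    simp
  rw [hsign, hcount, CharP.cast_eq_zero_iff K 2, ← even_iff_two_dvd]
  exact (neg_one_pow_eq_one_iff_even (by decide)).symm

theorem exists_algHom_symmetricSubalgebra {n : ℕ} (F : ℤ[X]) :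
    ∃ φ : MvPolynomial.symmetricSubalgebra (Fin n) ℤ →ₐ[ℤ] ℤ,
      ∀ (R : Type) [CommRing R] (x : Fin n → R),
        F.map (Int.castRingHom R) = ∏ i, (X - C (x i)) →
        ∀ p : MvPolynomial.symmetricSubalgebra (Fin n) ℤ,
          MvPolynomial.aeval x (p : MvPolynomial (Fin n) ℤ) = (φ p : R) := by
  refine ⟨(MvPolynomial.aeval fun i : Fin n => (-1) ^ ((i : ℕ) + 1) * F.coeff (n - (i + 1))).comp
    (MvPolynomial.esymmAlgEquiv (Fin n) ℤ (Fintype.card_fin n)).symm.toAlgHom, ?_⟩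
  intro R _ x hx p
  have key : (MvPolynomial.aeval x).comp ((MvPolynomial.symmetricSubalgebra (Fin n) ℤ).val.comp
      (MvPolynomial.esymmAlgHom (Fin n) ℤ n))
      = (Algebra.ofId ℤ R).comp (MvPolynomial.aeval
        fun i : Fin n => (-1) ^ ((i : ℕ) + 1) * F.coeff (n - (i + 1))) := by
    ext i
    have h1 := congrArg (fun P => coeff P (n - (i + 1))) hx
    have h2 := Multiset.prod_X_sub_C_coeff (Finset.univ.val.map x)
      (k := n - (i + 1)) (by simp)
    simp only [Multiset.map_map, Function.comp_def, Multiset.card_map, Finset.card_val,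
      Finset.card_univ, Fintype.card_fin] at h2
    have h3 : n - (n - ((i : ℕ) + 1)) = i + 1 := by omega
    rw [h3] at h2
    simp only [coeff_map, eq_intCast] at h1
    change _ = coeff (Multiset.map (fun i => X - C (x i)) Finset.univ.val).prod _ at h1
    rw [h2] at h1
    simp only [AlgHom.comp_apply, Subalgebra.coe_val, MvPolynomial.esymmAlgHom_apply,
      MvPolynomial.aeval_X, MvPolynomial.aeval_esymm_eq_multiset_esymm]
    rw [map_mul, Algebra.ofId_apply, Algebra.ofId_apply]
    simp only [algebraMap_int_eq, eq_intCast, h1]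
    push_cast
    rw [← mul_assoc, ← mul_pow, neg_one_mul, neg_neg, one_pow, one_mul]
  obtain ⟨q, rfl⟩ := (MvPolynomial.esymmAlgEquiv (Fin n) ℤ (Fintype.card_fin n)).surjective p
  rw [AlgHom.comp_apply]
  erw [AlgEquiv.symm_apply_apply]
  exact DFunLike.congr_fun key q

theorem exists_prod_sub_eight_mul {R ι : Type*} [CommRing R] [DecidableEq ι] (s : Finset ι)
    (a b : ι → R) :
    ∃ c, ∏ i ∈ s, (a i ^ 2 - 4 * b i)
      = (∏ i ∈ s, a i) ^ 2 - 4 * ∑ i ∈ s, b i * ∏ j ∈ s.erase i, a j ^ 2 + 8 * c := by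
  induction s using Finset.induction_on with
  | empty => exact ⟨0, by simp⟩
  | insert i s hi ih =>
    obtain ⟨c, hc⟩ := ih
    have : ∑ k ∈ s, b k * ∏ j ∈ (insert i s).erase k, a j ^ 2
        = a i ^ 2 * ∑ k ∈ s, b k * ∏ j ∈ s.erase k, a j ^ 2 := by
      rw [Finset.mul_sum]
      refine Finset.sum_congr rfl fun k hk => ?_
      rw [Finset.erase_insert_of_ne (by rintro rfl; exact hi hk), Finset.prod_insert (by simp [hi])]
      ring
    rw [Finset.prod_insert hi, Finset.prod_insert hi, Finset.sum_insert hi, hc, this,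
      Finset.erase_insert hi, Finset.prod_pow]
    exact ⟨2 * b i * (∑ k ∈ s, b k * ∏ j ∈ s.erase k, a j ^ 2) + (a i ^ 2 - 4 * b i) * c, by ring⟩

theorem monic_of_zmod_two {g : (ZMod 2)[X]} (hg : g ≠ 0) : g.Monic :=
  (Fin.exists_fin_two.1 ⟨g.leadingCoeff, rfl⟩).resolve_left (leadingCoeff_ne_zero.2 hg)

theorem exists_frobenius_cycle_of_irreducible {K : Type*} [Field K] [IsAlgClosed K]
    [Algebra (ZMod 2) K] {g : (ZMod 2)[X]} (hg : Irreducible g) :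
    ∃ x : Fin g.natDegree → K, (∀ i, x (finRotate _ i) = x i ^ 2) ∧
      g.map (algebraMap (ZMod 2) K) = ∏ i, (X - C (x i)) := by
  have : Fact (Irreducible g) := ⟨hg⟩
  let pb := AdjoinRoot.powerBasis hg.ne_zero
  have : Module.Finite (ZMod 2) (AdjoinRoot g) := pb.finite
  have : Finite (AdjoinRoot g) := Module.finite_of_finite (ZMod 2)
  have hrank : Module.finrank (ZMod 2) (AdjoinRoot g) = g.natDegree := by
    rw [pb.finrank, AdjoinRoot.powerBasis_dim]
  let φ := FiniteField.frobeniusAlgHom (ZMod 2) (AdjoinRoot g)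
  have hφ : ∀ a, φ a = a ^ 2 := fun a => by
    simp [φ]
  have hinj := (FiniteField.bijective_frobeniusAlgHom_pow (ZMod 2) (AdjoinRoot g)).1
  have hord : φ ^ g.natDegree = 1 := by
    rw [← hrank, ← FiniteField.orderOf_frobeniusAlgHom, pow_orderOf_eq_one]
  have hdeg : (g.map (algebraMap (ZMod 2) K)).degree ≠ 0 := by
    rw [degree_map]; exact (degree_pos_of_irreducible hg).ne'
  obtain ⟨α, hα⟩ := IsAlgClosed.exists_root _ hdeg
  have hα' : aeval α g = 0 := by rwa [IsRoot.def, eval_map_algebraMap] at hα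
  let ψ : AdjoinRoot g →ₐ[ZMod 2] K := AdjoinRoot.liftAlgHom g (Algebra.ofId _ _) α hα'
  let y : ℕ → AdjoinRoot g := fun k => (φ ^ k) (AdjoinRoot.root g)
  have hy : ∀ k, y (k + 1) = y k ^ 2 := fun k => by
    simp only [y, pow_succ' φ k, AlgHom.mul_apply, hφ]
  have hroot : ∀ (χ : AdjoinRoot g →ₐ[ZMod 2] K), aeval (χ (AdjoinRoot.root g)) g = 0 := by
    intro χ
    rw [aeval_algHom_apply, AdjoinRoot.aeval_eq, AdjoinRoot.mk_self, map_zero]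
  refine ⟨fun k => ψ (y k), fun i => ?_, ?_⟩
  · dsimp only
    rw [← map_pow, ← hy]
    congr 1
    have hn := i.neZero
    rw [finRotate_apply]
    rcases eq_or_ne ((i : ℕ) + 1) g.natDegree with h | h
    · have : ((i + 1 : Fin g.natDegree) : ℕ) = 0 := by
        rw [Fin.val_add, Fin.val_one', Nat.add_mod_mod, h, Nat.mod_self]
      simp only [y, this, h, hord, pow_zero]
    · have : ((i + 1 : Fin g.natDegree) : ℕ) = i + 1 := by
        rw [Fin.val_add, Fin.val_one', Nat.add_mod_mod, Nat.mod_eq_of_lt (by omega)]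
      rw [this]
  · have hxinj : Function.Injective fun k : Fin g.natDegree => ψ (y k) := by
      intro i j hij
      have h1 : φ ^ (i : ℕ) = φ ^ (j : ℕ) := AdjoinRoot.algHom_ext (ψ.injective hij)
      have := @hinj (Fin.cast hrank.symm i) (Fin.cast hrank.symm j) h1
      simpa [Fin.ext_iff] using this
    refine eq_of_monic_of_dvd_of_natDegree_le (monic_prod_of_monic _ _ fun i _ => monic_X_sub_C _)
      ((monic_of_zmod_two hg.ne_zero).map _) ?_ ?_
    · refine Finset.prod_dvd_of_coprime (fun i _ j _ hij => ?_) fun i _ => ?_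
      · exact pairwise_coprime_X_sub_C hxinj hij
      · rw [dvd_iff_isRoot, IsRoot.def, eval_map_algebraMap]
        exact hroot (ψ.comp (φ ^ (i : ℕ)))
    · simp [natDegree_map]

theorem exists_frobenius_perm_of_irreducible_factors {K : Type*} [Field K] [IsAlgClosed K]
    [Algebra (ZMod 2) K] (s : Multiset (ZMod 2)[X]) (hs : ∀ g ∈ s, Irreducible g) :
    ∃ (x : Fin s.prod.natDegree → K) (σ : Equiv.Perm (Fin s.prod.natDegree)),
      (∀ i, x (σ i) = x i ^ 2) ∧
      Equiv.Perm.sign σ = (-1) ^ (s.prod.natDegree + s.card) ∧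
      s.prod.map (algebraMap (ZMod 2) K) = ∏ i, (X - C (x i)) := by
  induction s using Multiset.induction_on with
  | empty =>
    have h0 : (Multiset.prod (0 : Multiset (ZMod 2)[X])).natDegree = 0 := by simp
    have : IsEmpty (Fin (Multiset.prod (0 : Multiset (ZMod 2)[X])).natDegree) := by
      rw [h0]; infer_instance
    exact ⟨isEmptyElim, 1, isEmptyElim, by rw [map_one, h0]; simp,
      by rw [Fintype.prod_empty]; simp⟩
  | cons g s ih =>
    obtain ⟨x, σ, hx, hσ, hprod⟩ := ih fun h hh => hs h (Multiset.mem_cons_of_mem hh)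
    have hg := hs g (Multiset.mem_cons_self g s)
    obtain ⟨y, hy, hyprod⟩ := exists_frobenius_cycle_of_irreducible (K := K) hg
    have hs0 : s.prod ≠ 0 := Multiset.prod_ne_zero fun h =>
      (hs 0 (Multiset.mem_cons_of_mem h)).ne_zero rfl
    have hdeg : (g ::ₘ s).prod.natDegree = g.natDegree + s.prod.natDegree := by
      rw [Multiset.prod_cons, natDegree_mul hg.ne_zero hs0]
    rw [hdeg]
    refine ⟨Sum.elim y x ∘ finSumFinEquiv.symm,
      finSumFinEquiv.permCongr (Equiv.Perm.sumCongr (finRotate _) σ), fun i => ?_, ?_, ?_⟩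
    · obtain ⟨i, rfl⟩ := finSumFinEquiv.surjective i
      cases i <;> simp [Equiv.permCongr_apply, hx, hy, -finSumFinEquiv_apply_left,
        -finSumFinEquiv_apply_right, -finRotate_apply]
    · rw [Equiv.Perm.sign_permCongr, Equiv.Perm.sign_sumCongr, sign_finRotate, hσ, ← pow_add,
        Multiset.card_cons]
      have := hg.natDegree_pos
      rw [show g.natDegree + s.prod.natDegree + (s.card + 1)
        = (g.natDegree - 1 + (s.prod.natDegree + s.card)) + 2 by omega, pow_add _ _ 2]
      simp
    · rw [Multiset.prod_cons, Polynomial.map_mul, hyprod, hprod, ← finSumFinEquiv.prod_comp,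
        Fintype.prod_sum_type]
      simp [-finSumFinEquiv_apply_left, -finSumFinEquiv_apply_right]

theorem res_eq_resultant_s13 (n : ℕ) (F G : ℤ[X]) :
    res (n + 1) n F G = resultant F G (n + 1) n := by
  have hsign : Equiv.Perm.sign (finRotate (n + (n + 1)) ^ (n + 1)) = 1 := by
    rw [map_pow, sign_finRotate, show n + (n + 1) - 1 = 2 * n by omega, pow_mul]
    simp
  have hval : ∀ (k : ℕ) (i : Fin (n + (n + 1))),
      (((finRotate (n + (n + 1)) ^ k) i : Fin _) : ℕ) = (i + k) % (n + (n + 1)) := by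
    intro k i
    induction k with
    | zero => simp [Nat.mod_eq_of_lt i.2]
    | succ k ih =>
      rw [pow_succ', Equiv.Perm.mul_apply, finRotate_apply, Fin.val_add, ih, Fin.val_one',
        Nat.add_mod_mod, Nat.mod_add_mod, add_assoc]
  have hmat : sylvesterMatrix (n + 1) n F G =
      ((sylvester G F n (n + 1)).transpose.submatrix Fin.revPerm Fin.revPerm).submatrix
        (finRotate (n + (n + 1)) ^ (n + 1)) id := by
    ext i j
    have hi := i.2
    have hj := j.2
    rw [sylvesterMatrix, Matrix.of_apply, Matrix.submatrix_apply, Matrix.submatrix_apply,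
      Matrix.transpose_apply, id, sylvester, Matrix.of_apply]
    by_cases h1 : (i : ℕ) < n
    · obtain ⟨k, hk⟩ : ∃ k : Fin n, Fin.revPerm ((finRotate (n + (n + 1)) ^ (n + 1)) i)
          = Fin.castAdd (n + 1) k := by
        refine ⟨⟨n - 1 - i, by omega⟩, Fin.ext ?_⟩
        simp only [Fin.revPerm_apply, Fin.val_rev, hval, Fin.val_castAdd]
        rw [Nat.mod_eq_of_lt (by omega)]
        omega
      have hk' := congrArg Fin.val hk
      simp only [Fin.revPerm_apply, Fin.val_rev, hval, Fin.val_castAdd] at hk'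
      rw [Nat.mod_eq_of_lt (by omega)] at hk'
      rw [if_pos h1, hk, Fin.addCases_left]
      simp only [Fin.revPerm_apply, Fin.val_rev, Set.mem_Icc]
      refine if_ctx_congr (by omega) (fun _ => congrArg _ (by omega)) fun _ => rfl
    · obtain ⟨k, hk⟩ : ∃ k : Fin (n + 1), Fin.revPerm ((finRotate (n + (n + 1)) ^ (n + 1)) i)
          = Fin.natAdd n k := by
        refine ⟨⟨n + n - i, by omega⟩, Fin.ext ?_⟩
        simp only [Fin.revPerm_apply, Fin.val_rev, hval, Fin.val_natAdd]
        rw [Nat.mod_eq_sub_mod (by omega), Nat.mod_eq_of_lt (by omega)]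
        omega
      have hk' := congrArg Fin.val hk
      simp only [Fin.revPerm_apply, Fin.val_rev, hval, Fin.val_natAdd] at hk'
      rw [Nat.mod_eq_sub_mod (by omega), Nat.mod_eq_of_lt (by omega)] at hk'
      rw [if_neg h1, hk, Fin.addCases_right]
      simp only [Fin.revPerm_apply, Fin.val_rev, Set.mem_Icc]
      refine if_ctx_congr (by omega) (fun _ => congrArg _ (by omega)) fun _ => rfl
  rw [res, hmat, Matrix.det_permute, hsign, Matrix.det_submatrix_equiv_self, Matrix.det_transpose,
    ← resultant, resultant_comm, (Nat.even_mul_succ_self n).neg_one_pow]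
  simp

theorem disc_eq_prod_sub_sq {L : Type*} [Field L] (F : ℤ[X]) {n : ℕ}
    (y : Fin n → L) (hy : F.map (Int.castRingHom L) = ∏ i, (X - C (y i))) (hF : F.Monic)
    (hn : F.natDegree = n) :
    (disc n F : L) = ∏ p ∈ ltPairs n, (y p.1 - y p.2) ^ 2 := by
  rcases n with _ | n
  · simp [disc, res, ltPairs]
  have hm : (F.map (Int.castRingHom L)).natDegree = n + 1 := by
    rw [hF.natDegree_map, hn]
  have hroots : (F.map (Int.castRingHom L)).roots = Finset.univ.val.map y := by
    rw [hy, ← roots_multiset_prod_X_sub_C (Finset.univ.val.map y), Multiset.map_map]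
    rfl
  have heval := resultant_eq_prod_eval (F.map (Int.castRingHom L))
    ((derivative F).map (Int.castRingHom L)) n
    (natDegree_map_le.trans ((natDegree_derivative_le _).trans (by omega)))
    (by rw [hy]; exact Splits.prod fun i _ => Splits.X_sub_C _)
  rw [hm] at heval
  have hres : ((res (n + 1) n F (derivative F) : ℤ) : L)
      = ∏ i, ∏ j ∈ Finset.univ.erase i, (y i - y j) := by
    rw [res_eq_resultant_s13, ← eq_intCast (Int.castRingHom L), ← resultant_map_map, heval,
      (hF.map _).leadingCoeff, one_pow, one_mul, hroots, Multiset.map_map]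
    change ∏ i, _ = _
    refine Finset.prod_congr rfl fun i _ => ?_
    rw [Function.comp_apply, ← derivative_map, hy, derivative_prod_finset, eval_finsetSum,
      Finset.sum_eq_single i]
    · simp [eval_prod]
    · intro j _ hji
      rw [eval_mul, eval_prod, Finset.prod_eq_zero
        (Finset.mem_erase.2 ⟨hji.symm, Finset.mem_univ i⟩) (by simp), zero_mul]
    · simp
  have hsplit : ∏ i, ∏ j ∈ Finset.univ.erase i, (y i - y j)
      = ∏ p ∈ ltPairs (n + 1), (y p.1 - y p.2) * (y p.2 - y p.1) := by
    rw [prod_ltPairs_eq_prod_prod fun i j => (y i - y j) * (y j - y i)]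
    have := Finset.prod_prod_Ioi_mul_eq_prod_prod_off_diag fun j i => y i - y j
    simp only [Finset.compl_singleton] at this
    exact this.symm
  have hcard : (ltPairs (n + 1)).card = (n + 1) * (n + 1 - 1) / 2 := by
    rw [Finset.card_eq_sum_ones, sum_ltPairs_eq_sum_sum fun _ _ => 1, ← Finset.sum_range_id,
      ← Finset.sum_range_reflect, Finset.sum_range]
    simp
  rw [disc, Int.cast_mul, Nat.add_sub_cancel, hres, hsplit]
  have : ∀ p ∈ ltPairs (n + 1), (y p.1 - y p.2) * (y p.2 - y p.1) = (-1) * (y p.1 - y p.2) ^ 2 :=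
    fun p _ => by ring
  rw [Finset.prod_congr rfl this, Finset.prod_mul_distrib, Finset.prod_const, hcard]
  push_cast
  rw [← mul_assoc, ← mul_pow]
  simp

theorem exists_eq_prod_X_sub_C {L : Type*} [Field L] {p : L[X]} (hs : p.Splits) (hp : p.Monic) :
    ∃ y : Fin p.natDegree → L, p = ∏ i, (X - C (y i)) := by
  rw [hs.natDegree_eq_card_roots, ← Multiset.length_toList]
  refine ⟨p.roots.toList.get, ?_⟩
  conv_lhs => rw [hs.eq_prod_roots_of_monic hp, ← Multiset.coe_toList p.roots]
  rw [Multiset.map_coe, Multiset.prod_coe]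
  exact (Fin.prod_univ_fun_getElem p.roots.toList fun a => X - C a).symm

theorem exists_disc_eq_sq_sub_four_mul (F : ℤ[X]) (hF : F.Monic) :
    ∃ a b : ℤ, disc F.natDegree F = a ^ 2 - 4 * b ∧
      ∀ (K : Type) [Field K] [CharP K 2] (x : Fin F.natDegree → K), Function.Injective x →
        F.map (Int.castRingHom K) = ∏ i, (X - C (x i)) →
          Odd a ∧ ∑ p ∈ ltPairs F.natDegree, x p.1 * x p.2 / (x p.1 + x p.2) ^ 2 = b := by
  obtain ⟨n, hn⟩ : ∃ n, F.natDegree = n := ⟨_, rfl⟩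
  rw [hn]
  obtain ⟨φ, hφ⟩ := exists_algHom_symmetricSubalgebra (n := n) F
  let P : MvPolynomial (Fin n) ℤ :=
    ∏ p ∈ ltPairs n, (MvPolynomial.X p.1 + MvPolynomial.X p.2)
  let D : MvPolynomial (Fin n) ℤ :=
    ∏ p ∈ ltPairs n, (MvPolynomial.X p.1 - MvPolynomial.X p.2) ^ 2
  let N : MvPolynomial (Fin n) ℤ := ∑ p ∈ ltPairs n, MvPolynomial.X p.1 * MvPolynomial.X p.2 *
    ∏ q ∈ (ltPairs n).erase p, (MvPolynomial.X q.1 + MvPolynomial.X q.2) ^ 2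
  have hP : P.IsSymmetric := by
    intro σ
    simp only [P, map_prod, map_add, MvPolynomial.rename_X]
    exact prod_ltPairs_perm (fun i j => (MvPolynomial.X i + MvPolynomial.X j :
      MvPolynomial (Fin n) ℤ)) (fun i j => add_comm _ _) σ
  have hD : D.IsSymmetric := by
    intro σ
    simp only [D, map_prod, map_sub, map_pow, MvPolynomial.rename_X]
    exact prod_ltPairs_perm (fun i j => ((MvPolynomial.X i - MvPolynomial.X j) ^ 2 :
      MvPolynomial (Fin n) ℤ)) (fun i j => by ring) σ
  obtain ⟨c, hc⟩ := exists_prod_sub_eight_mul (ltPairs n)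
    (fun p => (MvPolynomial.X p.1 + MvPolynomial.X p.2 : MvPolynomial (Fin n) ℤ))
    (fun p => MvPolynomial.X p.1 * MvPolynomial.X p.2)
  have hDP : D = P ^ 2 - 4 * (N - 2 * c) := by
    have : D = P ^ 2 - 4 * N + 8 * c := by
      rw [← hc]
      exact Finset.prod_congr rfl fun p _ => by ring
    rw [this]
    ring
  have hB : (N - 2 * c).IsSymmetric := by
    intro σ
    have h4 : (4 : MvPolynomial (Fin n) ℤ) ≠ 0 := by norm_num
    refine mul_left_cancel₀ h4 ?_
    have h := congrArg (MvPolynomial.rename σ) hDP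
    rw [hD σ, map_sub, map_mul, map_pow, hP σ, map_ofNat] at h
    linear_combination h - hDP
  have hDφ : φ ⟨D, hD⟩ = φ ⟨P, hP⟩ ^ 2 - 4 * φ ⟨N - 2 * c, hB⟩ := by
    rw [show (⟨D, hD⟩ : MvPolynomial.symmetricSubalgebra (Fin n) ℤ)
      = ⟨P, hP⟩ ^ 2 - 4 * ⟨N - 2 * c, hB⟩ from Subtype.ext hDP, map_sub, map_mul, map_pow,
      map_ofNat]
  refine ⟨φ ⟨P, hP⟩, φ ⟨N - 2 * c, hB⟩, ?_, ?_⟩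
  · rw [← hDφ]
    let L := AlgebraicClosure ℚ
    obtain ⟨y, hy⟩ : ∃ y : Fin n → L, F.map (Int.castRingHom L) = ∏ i, (X - C (y i)) := by
      have h := exists_eq_prod_X_sub_C (IsAlgClosed.splits (F.map (Int.castRingHom L))) (hF.map _)
      rwa [hF.natDegree_map, hn] at h
    have h1 := disc_eq_prod_sub_sq F y hy hF hn
    have h2 := hφ L y hy ⟨D, hD⟩
    simp only [D, map_prod, map_sub, map_pow, MvPolynomial.aeval_X] at h2
    rw [← h1] at h2
    exact_mod_cast h2
  · intro K _ _ x hx hxF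
    have hne : ∀ p ∈ ltPairs n, x p.1 + x p.2 ≠ 0 := fun p hp h =>
      (Finset.mem_filter.1 hp).2.ne (hx (by rwa [CharTwo.add_eq_zero] at h))
    have h1 := hφ K x hxF ⟨P, hP⟩
    have h2 := hφ K x hxF ⟨N - 2 * c, hB⟩
    simp only [P, map_prod, map_add, MvPolynomial.aeval_X] at h1
    have hodd : Odd (φ ⟨P, hP⟩) := by
      rw [← Int.not_even_iff_odd, even_iff_two_dvd]
      intro h
      refine Finset.prod_ne_zero_iff.2 hne (h1.trans ?_)
      exact (CharP.intCast_eq_zero_iff K 2 _).2 h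
    refine ⟨hodd, ?_⟩
    have hone : ∏ p ∈ ltPairs n, (x p.1 + x p.2) = 1 := by
      obtain ⟨m, hm⟩ := hodd
      rw [h1]
      change ((φ ⟨P, hP⟩ : ℤ) : K) = 1
      rw [hm]
      push_cast
      rw [CharTwo.two_eq_zero, zero_mul, zero_add]
    rw [← h2]
    simp only [N, map_sub, map_mul, map_sum, map_prod, map_pow, map_add, MvPolynomial.aeval_X,
      map_ofNat, CharTwo.two_eq_zero, zero_mul, sub_zero]
    refine Finset.sum_congr rfl fun p hp => ?_
    rw [div_eq_iff (pow_ne_zero 2 (hne p hp)), mul_assoc,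
      Finset.prod_erase_mul _ (fun q => (x q.1 + x q.2) ^ 2) hp, Finset.prod_pow, hone, one_pow,
      mul_one]

/-- **Stickelberger–Swan theorem.** Let `f ∈ 𝔽₂[x]` have no repeated roots (i.e. be
squarefree), let `t` be the number of monic irreducible factors of `f`, and let
`F ∈ ℤ[x]` be any monic lift of `f` to the integers.  Then `t ≡ deg f (mod 2)` if and
only if `disc F ≡ 1 (mod 8)`. -/
theorem stickelberger_swan (f : Polynomial (ZMod 2)) (hsf : Squarefree f)
    (F : Polynomial ℤ) (hmonic : F.Monic)
    (hlift : F.map (Int.castRingHom (ZMod 2)) = f) :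
    ((UniqueFactorizationMonoid.factors f).card ≡ f.natDegree [MOD 2] ↔
      disc F.natDegree F ≡ 1 [ZMOD 8]) := by
  let K := AlgebraicClosure (ZMod 2)
  have : CharP K 2 := charP_of_injective_algebraMap (algebraMap (ZMod 2) K).injective 2
  have hf0 : f ≠ 0 := hsf.ne_zero
  have hirr : ∀ g ∈ UniqueFactorizationMonoid.factors f, Irreducible g :=
    UniqueFactorizationMonoid.irreducible_of_factor
  have hprod : (UniqueFactorizationMonoid.factors f).prod = f :=
    eq_of_monic_of_associated
      (monic_of_zmod_two (Multiset.prod_ne_zero fun h => (hirr 0 h).ne_zero rfl))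
      (monic_of_zmod_two hf0) (UniqueFactorizationMonoid.factors_prod hf0)
  have hdeg : f.natDegree = F.natDegree := by rw [← hlift, hmonic.natDegree_map]
  have hfrob := exists_frobenius_perm_of_irreducible_factors (K := K) _ hirr
  rw [hprod, hdeg] at hfrob
  obtain ⟨x, σ, hσ, hsign, hx⟩ := hfrob
  have hinj : Function.Injective x := by
    rw [← separable_prod_X_sub_C_iff, ← hx]
    exact (PerfectField.separable_iff_squarefree.2 hsf).map
  obtain ⟨a, b, hab, h⟩ := exists_disc_eq_sq_sub_four_mul F hmonic
  have hxF : F.map (Int.castRingHom K) = ∏ i, (X - C (x i)) := by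
    rw [← hx, ← hlift, Polynomial.map_map]
    congr 1
  obtain ⟨ha, hb⟩ := h K x hinj hxF
  have hsum := sum_div_sq_eq_sign x hinj σ hσ
  rw [hb, hsign, neg_one_pow_eq_one_iff_even (by decide), CharP.intCast_eq_zero_iff K 2] at hsum
  have ha8 : a ^ 2 % 8 = 1 := by
    obtain ⟨k, hk⟩ := ha
    obtain ⟨m, hm⟩ := Int.even_mul_succ_self k
    have : a ^ 2 = 8 * m + 1 := by
      rw [hk]
      linear_combination 4 * hm
    omega
  rw [hdeg, hab, Int.ModEq, Nat.ModEq]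
  rw [Nat.even_iff] at hsum
  push_cast at hsum
  omega
end

section
/- The polynomial x^21 + x^7 + 1 is irreducible in F_2[x]. (In particular, the bound n/3 in the main theorem is sharp: here n = 21 ≡ −3 (mod 8) and the exponent 7 = n/3 is odd, yet the polynomial is irreducible.) -/
open Polynomial

/-- The multiplicative order of `2` modulo `49` is `21`. -/
lemma twenty_one_dvd_of_dvd_two_pow_sub_one {d : ℕ} (h : 49 ∣ 2 ^ d - 1) : 21 ∣ d := by
  have h2 : orderOf (2 : ZMod 49) = 21 := by
    rw [orderOf_eq_iff (by norm_num)]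
    decide
  rw [← h2]
  apply orderOf_dvd_of_pow_eq_one
  have hz := (ZMod.natCast_eq_zero_iff _ _).mpr h
  rw [Nat.cast_sub Nat.one_le_two_pow] at hz
  push_cast at hz
  exact sub_eq_zero.mp hz

/-- In characteristic two, every root of `x^21 + x^7 + 1` has multiplicative order `49`. -/
lemma orderOf_eq_of_pow_add_pow_add_one {K : Type*} [Field K] [CharP K 2] {a : K}
    (ha : a ^ 21 + a ^ 7 + 1 = 0) : orderOf a = 49 := by
  have h2 : (2 : K) = 0 := CharTwo.two_eq_zero
  have h : orderOf a = 7 ^ (1 + 1) := by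
    have : Fact (Nat.Prime 7) := ⟨by norm_num⟩
    refine orderOf_eq_prime_pow ?_ ?_
    · intro h1
      rw [pow_one] at h1
      apply one_ne_zero (α := K)
      linear_combination ha - (a ^ 14 + a ^ 7 + 2) * h1 - h2
    · norm_num
      linear_combination (a ^ 7 - 1) * (a ^ 21 + a ^ 14 + 1) * ha - (a ^ 7 - 1) * a ^ 21 * h2
  simpa using h

/-- The trinomial `x^21 + x^7 + 1` is irreducible in `𝔽₂[x]`.  (This shows the bound
`n/3` in the main theorem is sharp: `n = 21 ≡ -3 (mod 8)` and `7 = n/3` is odd, yet the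
polynomial is irreducible.) -/
theorem x21_x7_one_irreducible :
    Irreducible (X ^ 21 + X ^ 7 + 1 : Polynomial (ZMod 2)) := by
  set f : Polynomial (ZMod 2) := X ^ 21 + X ^ 7 + 1 with hf
  have hdeg : f.natDegree = 21 := by rw [hf]; compute_degree!
  have hf0 : f ≠ 0 := by
    intro h
    simp [h] at hdeg
  obtain ⟨g, hg, hgf⟩ := exists_irreducible_of_natDegree_pos (f := f) (by omega)
  have : Fact (Irreducible g) := ⟨hg⟩
  have : CharP (AdjoinRoot g) 2 := charP_of_injective_algebraMap' (ZMod 2) 2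
  let b := AdjoinRoot.powerBasis hg.ne_zero
  have : Module.Finite (ZMod 2) (AdjoinRoot g) := b.finite
  have : Finite (AdjoinRoot g) := Module.finite_of_finite (ZMod 2)
  have := Fintype.ofFinite (AdjoinRoot g)
  have hcard : Fintype.card (AdjoinRoot g) = 2 ^ g.natDegree := by
    rw [Module.card_eq_pow_finrank (K := ZMod 2), b.finrank, AdjoinRoot.powerBasis_dim, ZMod.card]
  have hroot : AdjoinRoot.root g ^ 21 + AdjoinRoot.root g ^ 7 + 1 = 0 := by
    simpa [hf] using AdjoinRoot.mk_eq_zero.mpr hgf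
  have hord := orderOf_eq_of_pow_add_pow_add_one hroot
  have hne : AdjoinRoot.root g ≠ 0 := by
    intro h
    simp [h] at hord
  have hdvd : 21 ∣ g.natDegree := by
    apply twenty_one_dvd_of_dvd_two_pow_sub_one
    rw [← hcard, ← hord]
    exact orderOf_dvd_of_pow_eq_one (FiniteField.pow_card_sub_one_eq_one _ hne)
  have hle : f.natDegree ≤ g.natDegree := hdeg ▸ Nat.le_of_dvd hg.natDegree_pos hdvd
  exact (associated_of_dvd_of_natDegree_le hgf hf0 hle).irreducible hg
end

section
/- Let k ≥ 1 and 0 < m < 8k. Then the trinomial x^{8k} + x^m + 1 ∈ F_2[x], whenever it is squarefree, has an even number of irreducible factors over F_2; in particular, x^{8k} + x^m + 1 is not irreducible in F_2[x]. -/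
open Polynomial

/-- The sum of `g x y` over all pairs of entries `x`, `y` of a list with `x` occurring before `y`. -/
def pairSum {K M : Type*} [AddCommMonoid M] (g : K → K → M) : List K → M
  | [] => 0
  | a :: l => (l.map (g a)).sum + pairSum g l

section PairSum

variable {K M : Type*} [AddCommMonoid M]

theorem pairSum_append (g : K → K → M) (l₁ l₂ : List K) :
    pairSum g (l₁ ++ l₂) =
      pairSum g l₁ + pairSum g l₂ + (l₁.map fun x => (l₂.map (g x)).sum).sum := by
  induction l₁ with
  | nil => simp [pairSum]
  | cons a l ih =>
    simp only [List.cons_append, pairSum, List.map_append, List.sum_append, ih, List.map_cons,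
      List.sum_cons]
    abel

theorem pairSum_perm {g : K → K → M} (hg : ∀ x y, g x y = g y x) {l₁ l₂ : List K}
    (h : l₁.Perm l₂) : pairSum g l₁ = pairSum g l₂ := by
  induction h with
  | nil => rfl
  | cons a h ih => simp only [pairSum, ih, (h.map (g a)).sum_eq]
  | swap a b l =>
    simp only [pairSum, List.map_cons, List.sum_cons, hg a b]
    abel
  | trans _ _ ih₁ ih₂ => exact ih₁.trans ih₂

theorem pairSum_add (g h : K → K → M) (l : List K) :
    pairSum (fun x y => g x y + h x y) l = pairSum g l + pairSum h l := by
  induction l with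
  | nil => simp [pairSum]
  | cons a l ih =>
    simp only [pairSum, ih, List.sum_map_add]
    abel

theorem pairSum_map {L : Type*} (g : K → K → M) (e : L → K) (l : List L) :
    pairSum g (l.map e) = pairSum (fun x y => g (e x) (e y)) l := by
  induction l with
  | nil => rfl
  | cons a l ih => simp only [List.map_cons, pairSum, ih, List.map_map]; rfl

theorem pairSum_ofFn (g : K → K → M) {n : ℕ} (a : Fin n → K) :
    pairSum g (List.ofFn a) = ∑ i, ∑ j ∈ Finset.Ioi i, g (a i) (a j) := by
  induction n with
  | zero => simp [pairSum]
  | succ n ih =>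
    simp only [List.ofFn_succ, pairSum, ih, Fin.sum_univ_succ, Fin.sum_Ioi_zero, Fin.sum_Ioi_succ,
      List.map_ofFn, List.sum_ofFn, Function.comp_apply]

end PairSum

/-- The summand `xy / (x + y)²` of the Berlekamp discriminant. -/
def berlekampTerm {K : Type*} [Field K] (x y : K) : K := x * y / (x + y) ^ 2

section CharTwo

variable {K : Type*} [Field K]

theorem berlekampTerm_comm (x y : K) : berlekampTerm x y = berlekampTerm y x := by
  rw [berlekampTerm, berlekampTerm, mul_comm, add_comm]

variable [CharP K 2]

theorem berlekampTerm_eq (x y : K) :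
    berlekampTerm x y = x ^ 2 / (x ^ 2 + y ^ 2) + x / (x + y) := by
  rw [berlekampTerm, ← CharTwo.add_sq]
  rcases eq_or_ne (x + y) 0 with h | h
  · simp [h]
  · field_simp
    linear_combination -(CharTwo.two_eq_zero (R := K)) * x ^ 2

/-- The contribution of a Frobenius-stable pair of lists to the Berlekamp discriminant vanishes. -/
theorem sum_berlekampTerm_eq_zero {l₁ l₂ : List K} (h₁ : (l₁.map (· ^ 2)).Perm l₁)
    (h₂ : (l₂.map (· ^ 2)).Perm l₂) :
    (l₁.map fun x => (l₂.map (berlekampTerm x)).sum).sum = 0 := by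
  have key : (l₁.map fun x => (l₂.map fun y => x ^ 2 / (x ^ 2 + y ^ 2)).sum).sum =
      (l₁.map fun x => (l₂.map fun y => x / (x + y)).sum).sum := by
    rw [← (h₁.map fun x => (l₂.map fun y => x / (x + y)).sum).sum_eq, List.map_map]
    congr 1
    refine List.map_congr_left fun x _ => ?_
    rw [Function.comp_apply, ← (h₂.map fun y => x ^ 2 / (x ^ 2 + y)).sum_eq, List.map_map]
    rfl
  have e : ∀ x : K, berlekampTerm x = fun y => x ^ 2 / (x ^ 2 + y ^ 2) + x / (x + y) :=
    fun x => funext (berlekampTerm_eq x)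
  simp only [e, List.sum_map_add, key, CharTwo.add_self_eq_zero]

/-- The Berlekamp discriminant of a single Frobenius orbit `a, t`. -/
theorem pairSum_berlekampTerm_cycle {a : K} {t : List K} (ha : a ∉ t)
    (h : (a :: t).map (· ^ 2) = t ++ [a]) :
    pairSum berlekampTerm (a :: t) = t.length := by
  have e : (berlekampTerm : K → K → K) = fun x y => x ^ 2 / (x ^ 2 + y ^ 2) + x / (x + y) :=
    funext₂ berlekampTerm_eq
  have key : (t.map fun x => x / (x + a)).sum + (t.map fun x => a / (a + x)).sum = t.length := by
    rw [← List.sum_map_add, List.map_congr_left (g := fun _ => (1 : K))]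
    · simp
    · intro x hx
      have : x + a ≠ 0 := fun h0 => ha (by rwa [← CharTwo.add_eq_zero.mp h0])
      rw [add_comm a x, ← add_div, div_self this]
  rw [e, pairSum_add, ← pairSum_map (fun x y => x / (x + y)) (· ^ 2), h, pairSum_append]
  simp only [pairSum, List.map_cons, List.map_nil, List.sum_cons, List.sum_nil, add_zero]
  linear_combination key + CharTwo.add_self_eq_zero (pairSum (fun x y => x / (x + y)) t)

end CharTwo

section Roots

variable {K : Type*} [Field K] [Algebra (ZMod 2) K]

theorem aeval_sq (q : (ZMod 2)[X]) (x : K) : aeval (x ^ 2) q = aeval x q ^ 2 := by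
  rw [← expand_aeval, ZMod.expand_card, map_pow]

theorem map_sq_perm_of_eq_roots {q : (ZMod 2)[X]} {l : List K}
    (hl : (l : Multiset K) = (q.map (algebraMap (ZMod 2) K)).roots) (hn : l.Nodup) :
    (l.map (· ^ 2)).Perm l := by
  have : CharP K 2 := charP_of_injective_algebraMap' (ZMod 2) 2
  have hinj : Function.Injective fun x : K => x ^ 2 := frobenius_inj K 2
  refine ((hn.map hinj).subperm fun y hy => ?_).perm_of_length_le (by simp)
  obtain ⟨x, hx, rfl⟩ := List.mem_map.mp hy
  rw [← Multiset.mem_coe, hl] at hx ⊢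
  have h0 := (mem_roots'.mp hx).1
  refine mem_roots'.mpr ⟨h0, ?_⟩
  have hx := (mem_roots'.mp hx).2
  rw [IsRoot, eval_map_algebraMap] at hx ⊢
  rw [aeval_sq, hx, zero_pow two_ne_zero]

/-- The roots of an irreducible polynomial over `𝔽₂` form one Frobenius orbit. -/
theorem exists_roots_eq_cycle {p : (ZMod 2)[X]} (hp : Irreducible p)
    (hs : (p.map (algebraMap (ZMod 2) K)).Splits) :
    ∃ (a : K) (t : List K), ((a :: t : List K) : Multiset K) =
      (p.map (algebraMap (ZMod 2) K)).roots ∧ a ∉ t ∧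
      (a :: t).map (· ^ 2) = t ++ [a] ∧ t.length + 1 = p.natDegree := by
  have : CharP K 2 := charP_of_injective_algebraMap' (ZMod 2) 2
  obtain ⟨a, ha⟩ := hs.exists_eval_eq_zero (by
    rw [degree_map]; exact (degree_pos_of_irreducible hp).ne')
  rw [eval_map_algebraMap] at ha
  have hiff (e : ℕ) : p.natDegree ∣ e ↔ a ^ 2 ^ e = a := by
    rw [hp.natDegree_dvd_iff_dvd_X_pow_card_pow_sub_X, ← hp.dvd_iff_aeval_eq_zero ha]
    simp [sub_eq_zero]
  obtain ⟨d, hd⟩ : ∃ d, p.natDegree = d + 1 := Nat.exists_eq_add_one.mpr hp.natDegree_pos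
  have hfix : a ^ 2 ^ (d + 1) = a := (hiff _).1 (by rw [hd])
  have hnd : ((List.range (d + 1)).map fun s => a ^ 2 ^ s).Nodup := by
    refine List.Nodup.map_on ?_ List.nodup_range
    have key : ∀ s t, s ≤ t → t < d + 1 → a ^ 2 ^ s = a ^ 2 ^ t → s = t := by
      intro s t hst ht h
      obtain ⟨e, rfl⟩ := Nat.exists_eq_add_of_le hst
      have h1 : a ^ 2 ^ e = a := by
        refine (iterateFrobenius_inj K 2 s) ?_
        simp only [iterateFrobenius_def]
        rw [h, ← pow_mul, ← pow_add, add_comm]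
      have := (hiff e).2 h1
      have := Nat.eq_zero_of_dvd_of_lt this (by omega)
      omega
    intro s hs t ht h
    rw [List.mem_range] at hs ht
    rcases le_total s t with h' | h'
    · exact key s t h' ht h
    · exact (key t s h' hs h.symm).symm
  have hp0 : p.map (algebraMap (ZMod 2) K) ≠ 0 := map_ne_zero hp.ne_zero
  have hcons : (List.range (d + 1)).map (fun s => a ^ 2 ^ s) =
      a :: (List.range d).map fun s => a ^ 2 ^ (s + 1) := by
    rw [List.range_succ_eq_map]; simp
  refine ⟨a, (List.range d).map fun s => a ^ 2 ^ (s + 1), ?_, ?_, ?_, by simp [hd]⟩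
  · rw [← hcons]
    refine Multiset.eq_of_le_of_card_le ?_ ?_
    · rw [Multiset.le_iff_subset (Multiset.coe_nodup.mpr hnd)]
      intro x hx
      simp only [Multiset.mem_coe, List.mem_map] at hx
      obtain ⟨s, -, rfl⟩ := hx
      rw [mem_roots hp0, IsRoot, eval_map_algebraMap]
      induction s with
      | zero => simpa using ha
      | succ s ih => rw [pow_succ, pow_mul, aeval_sq, ih, zero_pow two_ne_zero]
    · rw [← hs.natDegree_eq_card_roots]; simp [hd]
  · rw [hcons] at hnd
    exact (List.nodup_cons.mp hnd).1
  · rw [← hcons, List.map_map]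
    have : [a] = [d].map fun s => a ^ 2 ^ (s + 1) := by simp [hfix]
    rw [this, ← List.map_append, ← List.range_succ]
    exact List.map_congr_left fun s _ => by simp only [Function.comp_apply, ← pow_mul, ← pow_succ]

/-- Stickelberger's parity theorem over `𝔽₂`, in Berlekamp's form. -/
theorem pairSum_berlekampTerm_roots (s : Multiset (ZMod 2)[X]) (hs : ∀ p ∈ s, Irreducible p)
    (hsp : (s.prod.map (algebraMap (ZMod 2) K)).Splits) {l : List K}
    (hl : (l : Multiset K) = (s.prod.map (algebraMap (ZMod 2) K)).roots) (hn : l.Nodup) :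
    pairSum berlekampTerm l = (s.prod.natDegree + s.card : ℕ) := by
  have : CharP K 2 := charP_of_injective_algebraMap' (ZMod 2) 2
  induction s using Multiset.induction_on generalizing l with
  | empty =>
    have : l = [] := by simpa using hl
    simp [this, pairSum]
  | cons p s ih =>
    have hp := hs p (Multiset.mem_cons_self p s)
    have hs' : ∀ q ∈ s, Irreducible q := fun q hq => hs q (Multiset.mem_cons_of_mem hq)
    have hs0 : s.prod ≠ 0 := Multiset.prod_ne_zero fun h => (hs' 0 h).ne_zero rfl
    rw [Multiset.prod_cons, Polynomial.map_mul] at hl hsp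
    have h0 := mul_ne_zero (map_ne_zero (f := algebraMap (ZMod 2) K) hp.ne_zero)
      (map_ne_zero (f := algebraMap (ZMod 2) K) hs0)
    rw [roots_mul h0] at hl
    obtain ⟨a, t, hr, hat, hc, ht⟩ :=
      exists_roots_eq_cycle hp (hsp.of_dvd h0 (dvd_mul_right _ _))
    set l₂ := (s.prod.map (algebraMap (ZMod 2) K)).roots.toList
    have hl₂' : (l₂ : Multiset K) = (s.prod.map (algebraMap (ZMod 2) K)).roots :=
      Multiset.coe_toList _
    rw [← hr, ← hl₂', Multiset.coe_add, Multiset.coe_eq_coe] at hl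
    have hn' := hl.nodup hn
    rw [pairSum_perm berlekampTerm_comm hl, pairSum_append, pairSum_berlekampTerm_cycle hat hc,
      ih hs' (hsp.of_dvd h0 (dvd_mul_left _ _)) hl₂' hn'.of_append_right,
      sum_berlekampTerm_eq_zero (map_sq_perm_of_eq_roots hr hn'.of_append_left)
        (map_sq_perm_of_eq_roots hl₂' hn'.of_append_right),
      Multiset.prod_cons, natDegree_mul hp.ne_zero hs0, ← ht, Multiset.card_cons]
    push_cast
    linear_combination -(CharTwo.two_eq_zero (R := K))

end Roots

section Trinomial

variable {A : Type*} [CommRing A] {n m : ℕ}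

theorem monic_trinomial (h : m < n) : (X ^ n + X ^ m + 1 : A[X]).Monic := by
  rw [add_assoc]
  exact monic_X_pow_add ((degree_le_of_natDegree_le (by compute_degree)).trans_lt
    (Nat.cast_lt.mpr h))

theorem natDegree_trinomial [Nontrivial A] (h : m < n) :
    (X ^ n + X ^ m + 1 : A[X]).natDegree = n := by
  have hlow : (X ^ m + 1 : A[X]).natDegree ≤ m := by compute_degree
  rw [add_assoc, natDegree_add_eq_left_of_natDegree_lt, natDegree_X_pow]
  rw [natDegree_X_pow]
  exact hlow.trans_lt h

end Trinomial

section Integral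

theorem prod_one_sub_four_mul {A ι : Type*} [CommRing A] (h : (8 : A) = 0) (s : Finset ι)
    (g : ι → A) : ∏ i ∈ s, (1 - 4 * g i) = 1 - 4 * ∑ i ∈ s, g i := by
  classical
  induction s using Finset.induction_on with
  | empty => simp
  | insert a s ha ih =>
    rw [Finset.prod_insert ha, Finset.sum_insert ha, ih]
    linear_combination 2 * g a * (∑ i ∈ s, g i) * h

theorem prod_Ioi_neg_one {A : Type*} [CommRing A] (k : ℕ) :
    ∏ i : Fin (8 * k), ∏ _j ∈ Finset.Ioi i, (-1 : A) = 1 := by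
  simp only [Finset.prod_const, Fin.card_Ioi, Finset.prod_pow_eq_pow_sum]
  rw [Fin.sum_univ_eq_sum_range fun i => 8 * k - 1 - i, Finset.sum_range_reflect (fun i => i)]
  apply Even.neg_one_pow
  have h := Finset.sum_range_id_mul_two (8 * k)
  exact ⟨2 * (k * (8 * k - 1)), by linarith⟩

variable {R : Type*} [CommRing R] {k m : ℕ} {α : Fin (8 * k) → R}

theorem trinomial_root_pow (h : (X ^ (8 * k) + X ^ m + 1 : R[X]) = ∏ i, (X - C (α i)))
    (i : Fin (8 * k)) : α i ^ (8 * k) + α i ^ m + 1 = 0 := by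
  have := congrArg (eval (α i)) h
  rw [eval_prod, Finset.prod_eq_zero (Finset.mem_univ i) (by simp)] at this
  simpa using this

theorem isUnit_trinomial_root (hk : 1 ≤ k) (hm : 0 < m)
    (h : (X ^ (8 * k) + X ^ m + 1 : R[X]) = ∏ i, (X - C (α i)))
    (i : Fin (8 * k)) : IsUnit (α i) := by
  have h0 := trinomial_root_pow h i
  obtain ⟨e, rfl⟩ := Nat.exists_eq_add_of_lt hm
  obtain ⟨d, hd⟩ : ∃ d, 8 * k = d + 1 := ⟨8 * k - 1, by omega⟩
  rw [hd] at h0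
  refine IsUnit.of_mul_eq_one (-(α i ^ d + α i ^ e)) ?_
  rw [zero_add] at h0
  linear_combination -h0

variable [IsDomain R] [CharZero R]

theorem prod_root_add_root (hk : 1 ≤ k) (hm : Odd m)
    (h : (X ^ (8 * k) + X ^ m + 1 : R[X]) = ∏ i, (X - C (α i))) (i : Fin (8 * k)) :
    ∏ j ∈ {i}ᶜ, (α i + α j) = -α i ^ (m - 1) := by
  have h0 := trinomial_root_pow h i
  have hu := isUnit_trinomial_root hk hm.pos h i
  have h1 := congrArg (eval (-α i)) h
  have e : ∀ j, -α i - α j = -(α i + α j) := fun j => by ring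
  simp only [eval_prod, eval_add, eval_pow, eval_X, eval_one, eval_sub, eval_C, e,
    Finset.prod_neg, Finset.card_univ, Fintype.card_fin, hm.neg_pow] at h1
  have h8 : Even (8 * k) := ⟨4 * k, by ring⟩
  rw [h8.neg_pow, h8.neg_one_pow, one_mul, Fintype.prod_eq_mul_prod_compl i] at h1
  obtain ⟨e, rfl⟩ : ∃ e, m = e + 1 := ⟨m - 1, by have := hm.pos; omega⟩
  rw [Nat.add_sub_cancel]
  refine mul_left_cancel₀ (mul_ne_zero two_ne_zero hu.ne_zero) ?_
  linear_combination h0 - h1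

theorem prod_root_sub_root (hk : 1 ≤ k) (hm : Odd m) (hmk : m < 8 * k)
    (h : (X ^ (8 * k) + X ^ m + 1 : R[X]) = ∏ i, (X - C (α i))) (i : Fin (8 * k)) :
    ∏ j ∈ {i}ᶜ, (α i - α j) =
      -(8 * (k * α i ^ (8 * k - m)) + m) * ∏ j ∈ {i}ᶜ, (α i + α j) := by
  rw [prod_root_add_root hk hm h]
  have h1 := Lagrange.eval_nodal_derivative_eval_node_eq (v := α) (Finset.mem_univ i)
  rw [Lagrange.nodal, ← h, Lagrange.eval_nodal, ← Finset.compl_singleton] at h1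
  rw [← h1]
  obtain ⟨e, rfl⟩ : ∃ e, m = e + 1 := ⟨m - 1, by have := hm.pos; omega⟩
  have : 8 * k - 1 = (8 * k - (e + 1)) + e := by omega
  simp only [derivative_add, derivative_X_pow, derivative_one, eval_add, eval_mul, eval_C,
    eval_pow, eval_X, eval_zero, Nat.add_sub_cancel]
  rw [this, pow_add]
  push_cast
  ring

theorem isUnit_root_add_root (hk : 1 ≤ k) (hm : Odd m)
    (h : (X ^ (8 * k) + X ^ m + 1 : R[X]) = ∏ i, (X - C (α i))) {i j : Fin (8 * k)}
    (hij : i ≠ j) : IsUnit (α i + α j) := by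
  have := ((isUnit_trinomial_root hk hm.pos h i).pow (m - 1)).neg
  rw [← prod_root_add_root hk hm h] at this
  exact isUnit_of_dvd_unit
    (Finset.dvd_prod_of_mem (fun j => α i + α j) (by simpa using hij.symm)) this

/-- The Berlekamp discriminant of the trinomial vanishes, because its discriminant in
characteristic zero is `1` modulo `8`. -/
theorem pairSum_berlekampTerm_trinomial {K : Type*} [Field K] [CharP K 2] (φ : R →+* K)
    (hk : 1 ≤ k) (hm : Odd m) (hmk : m < 8 * k)
    (h : (X ^ (8 * k) + X ^ m + 1 : R[X]) = ∏ i, (X - C (α i))) :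
    pairSum berlekampTerm (List.ofFn fun i => φ (α i)) = 0 := by
  have hv : ∀ i j, ∃ v, i ≠ j → (α i + α j) * v = 1 := fun i j => by
    by_cases hij : i = j
    · exact ⟨0, fun h' => absurd hij h'⟩
    · obtain ⟨v, hv⟩ := (isUnit_root_add_root hk hm h hij).exists_right_inv
      exact ⟨v, fun _ => hv⟩
  choose v hv using hv
  set g : Fin (8 * k) → Fin (8 * k) → R := fun i j => α i * α j * v i j ^ 2
  have hadd := Finset.prod_prod_Ioi_mul_eq_prod_prod_off_diag fun j i => α i + α j
  have hsub := Finset.prod_prod_Ioi_mul_eq_prod_prod_off_diag fun j i => α i - α j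
  have hP : ∏ i, ∏ j ∈ {i}ᶜ, (α i + α j) ≠ 0 :=
    Finset.prod_ne_zero_iff.mpr fun i _ => by
      rw [prod_root_add_root hk hm h]
      exact ((isUnit_trinomial_root hk hm.pos h i).pow _).neg.ne_zero
  have hneg : ∏ i, ∏ j ∈ Finset.Ioi i, -1 * (1 - 4 * g i j) =
      ∏ i, ∏ j ∈ Finset.Ioi i, (1 - 4 * g i j) := by
    simp only [Finset.prod_mul_distrib, prod_Ioi_neg_one, one_mul]
  have hprod : ∏ i, ∏ j ∈ Finset.Ioi i, (1 - 4 * g i j) =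
      ∏ i, -(8 * (k * α i ^ (8 * k - m)) + (m : R)) := by
    refine mul_right_cancel₀ hP ?_
    rw [← Finset.prod_mul_distrib (f := fun i => -(8 * (k * α i ^ (8 * k - m)) + (m : R))),
      ← Finset.prod_congr rfl fun i _ => prod_root_sub_root hk hm hmk h i, ← hsub, ← hadd,
      ← hneg, ← Finset.prod_mul_distrib]
    simp only [← Finset.prod_mul_distrib]
    refine Finset.prod_congr rfl fun i _ => Finset.prod_congr rfl fun j hj => ?_
    have := hv i j (Finset.mem_Ioi.mp hj).ne
    linear_combination 4 * α i * α j * ((α i + α j) * v i j + 1) * this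
  have hdvd : (8 : R) ∣ 4 * ∑ i, ∑ j ∈ Finset.Ioi i, g i j := by
    rw [← Ideal.mem_span_singleton, ← Ideal.Quotient.eq_zero_iff_mem]
    set π := Ideal.Quotient.mk (Ideal.span {(8 : R)})
    have h8 : (8 : R ⧸ Ideal.span {(8 : R)}) = 0 := by
      have : π 8 = 0 := Ideal.Quotient.eq_zero_iff_mem.mpr (Ideal.mem_span_singleton_self 8)
      rwa [map_ofNat] at this
    have hπ := congrArg π hprod
    obtain ⟨c, rfl⟩ := hm
    simp only [map_prod, map_sub, map_one, map_mul, map_ofNat, prod_one_sub_four_mul h8, map_neg,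
      map_add, h8, zero_mul, zero_add, map_natCast, Finset.prod_const, Finset.card_univ,
      Fintype.card_fin] at hπ
    have hsq : (-((2 * c + 1 : ℕ) : R ⧸ Ideal.span {(8 : R)})) ^ 2 = 1 := by
      obtain ⟨d, hd⟩ := Nat.even_mul_succ_self c
      have hd' := congrArg (Nat.cast (R := R ⧸ Ideal.span {(8 : R)})) hd
      push_cast at hd' ⊢
      linear_combination 4 * hd' + d * h8
    have h1 : (-((2 * c + 1 : ℕ) : R ⧸ Ideal.span {(8 : R)})) ^ (8 * k) = 1 := by
      rw [show 8 * k = 2 * (4 * k) by ring, pow_mul, hsq, one_pow]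
    rw [h1] at hπ
    simp only [map_mul, map_ofNat, map_sum]
    linear_combination -hπ
  obtain ⟨c, hc⟩ := hdvd
  have hβ : ∑ i, ∑ j ∈ Finset.Ioi i, g i j = 2 * c :=
    mul_left_cancel₀ (show (4 : R) ≠ 0 by norm_num) (by linear_combination hc)
  rw [pairSum_ofFn]
  have hφ := congrArg φ hβ
  rw [map_mul, map_ofNat, CharTwo.two_eq_zero, zero_mul] at hφ
  simp only [map_sum] at hφ
  rw [← hφ]
  refine Finset.sum_congr rfl fun i _ => Finset.sum_congr rfl fun j hj => ?_
  have := congrArg φ (hv i j (Finset.mem_Ioi.mp hj).ne)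
  rw [map_mul, map_one, map_add] at this
  have h0 : φ (α i) + φ (α j) ≠ 0 := left_ne_zero_of_mul_eq_one this
  rw [berlekampTerm, div_eq_iff (pow_ne_zero 2 h0)]
  simp only [g, map_mul, map_pow]
  linear_combination -φ (α i) * φ (α j) * ((φ (α i) + φ (α j)) * φ (v i j) + 1) * this

end Integral

/-- A field of characteristic two in which the Berlekamp discriminant of the trinomial vanishes. -/
theorem exists_roots_trinomial {k m : ℕ} (hk : 1 ≤ k) (hm : Odd m) (hmk : m < 8 * k) :
    ∃ (K : Type) (_ : Field K) (_ : Algebra (ZMod 2) K) (l : List K),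
      l.Nodup ∧
      (X ^ (8 * k) + X ^ m + 1 : K[X]) = (l.map fun a => X - C a).prod ∧
      pairSum berlekampTerm l = 0 := by
  let L := AlgebraicClosure ℚ
  let R := integralClosure ℤ L
  let F : R[X] := X ^ (8 * k) + X ^ m + 1
  have hs : F.Splits := by
    refine Splits.of_splits_map_of_injective (i := algebraMap R L)
      (FaithfulSMul.algebraMap_injective R L) (IsAlgClosed.splits _) fun a ha => ?_
    have haF := (mem_roots'.mp ha).2
    have : IsIntegral ℤ a := by
      refine ⟨X ^ (8 * k) + X ^ m + 1, ?_, ?_⟩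
      · exact monic_trinomial hmk
      · simpa [F] using haF
    exact ⟨⟨a, this⟩, rfl⟩
  obtain ⟨α, hα⟩ : ∃ α : Fin (8 * k) → R, (List.ofFn α : Multiset R) = F.roots := by
    have hlen : F.roots.toList.length = 8 * k := by
      rw [Multiset.length_toList, ← hs.natDegree_eq_card_roots, natDegree_trinomial hmk]
    refine ⟨fun i => F.roots.toList.get (i.cast hlen.symm), ?_⟩
    rw [← List.ofFn_congr hlen, List.ofFn_get, Multiset.coe_toList]
  have hF : (X ^ (8 * k) + X ^ m + 1 : R[X]) = ∏ i, (X - C (α i)) := by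
    have := hs.eq_prod_roots_of_monic (monic_trinomial hmk)
    rw [← hα, Multiset.map_coe, Multiset.prod_coe, List.map_ofFn, List.prod_ofFn] at this
    exact this
  have : (Ideal.span {(2 : ℤ)}).IsMaximal :=
    PrincipalIdealRing.isMaximal_of_irreducible Int.prime_two.irreducible
  obtain ⟨Q, hQ, hQ2⟩ := Ideal.exists_ideal_over_maximal_of_isIntegral (S := R)
    (Ideal.span {(2 : ℤ)}) (by
      rw [(RingHom.injective_iff_ker_eq_bot _).mp (FaithfulSMul.algebraMap_injective ℤ R)]
      exact bot_le)
  let K := R ⧸ Q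
  let _ : Field K := Ideal.Quotient.field Q
  let φ : R →+* K := Ideal.Quotient.mk Q
  have h2 : (2 : K) = 0 := by
    have : (2 : ℤ) ∈ Q.comap (algebraMap ℤ R) := hQ2 ▸ Ideal.mem_span_singleton_self 2
    have : φ 2 = 0 := Ideal.Quotient.eq_zero_iff_mem.mpr (by simpa using this)
    rwa [map_ofNat] at this
  have : CharP K 2 := CharTwo.of_one_ne_zero_of_two_eq_zero one_ne_zero h2
  refine ⟨K, inferInstance, ZMod.algebra K 2, List.ofFn fun i => φ (α i), ?_, ?_,
    pairSum_berlekampTerm_trinomial φ hk hm hmk hF⟩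
  · rw [List.nodup_ofFn]
    intro i j hij
    by_contra hne
    have := (isUnit_root_add_root hk hm hF hne).map φ
    rw [map_add, show φ (α i) = φ (α j) from hij, CharTwo.add_self_eq_zero] at this
    exact not_isUnit_zero this
  · have := congrArg (Polynomial.map φ) hF
    rw [List.map_ofFn, List.prod_ofFn]
    simpa [Polynomial.map_prod] using this

theorem monic_of_ne_zero {q : (ZMod 2)[X]} (h : q ≠ 0) : q.Monic :=
  (by decide : ∀ c : ZMod 2, c ≠ 0 → c = 1) _ (leadingCoeff_ne_zero.mpr h)

theorem even_card_factors_trinomial {k m : ℕ} (hk : 1 ≤ k) (hm : Odd m) (hmk : m < 8 * k) :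
    Even (UniqueFactorizationMonoid.factors (X ^ (8 * k) + X ^ m + 1 : (ZMod 2)[X])).card := by
  obtain ⟨K, _, _, l, hn, hl, h0⟩ := exists_roots_trinomial hk hm hmk
  have : CharP K 2 := charP_of_injective_algebraMap' (ZMod 2) 2
  set f : (ZMod 2)[X] := X ^ (8 * k) + X ^ m + 1 with hf
  have hmap : f.map (algebraMap (ZMod 2) K) = (l.map fun a => X - C a).prod := by
    rw [← hl]; simp [hf]
  have hf0 : f ≠ 0 := (monic_trinomial hmk).ne_zero
  have hprod : (UniqueFactorizationMonoid.factors f).prod = f :=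
    have h := UniqueFactorizationMonoid.factors_prod hf0
    eq_of_monic_of_associated (monic_of_ne_zero (h.ne_zero_iff.mpr hf0)) (monic_trinomial hmk) h
  have hroots : (l : Multiset K) = (f.map (algebraMap (ZMod 2) K)).roots := by
    have := roots_multiset_prod_X_sub_C (l : Multiset K)
    rw [Multiset.map_coe, Multiset.prod_coe] at this
    rw [hmap, this]
  have hsplits : (f.map (algebraMap (ZMod 2) K)).Splits := by
    rw [hmap]
    exact Splits.listProd (by simp [Splits.X_sub_C])
  have key := pairSum_berlekampTerm_roots (K := K) (UniqueFactorizationMonoid.factors f)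
    (fun p hp => UniqueFactorizationMonoid.irreducible_of_factor p hp)
    (by rwa [hprod]) (by rwa [hprod]) hn
  rw [h0, hprod, natDegree_trinomial hmk, eq_comm, CharP.cast_eq_zero_iff K 2,
    ← even_iff_two_dvd] at key
  exact (Nat.even_add.mp key).1 ⟨4 * k, by ring⟩

theorem odd_of_squarefree_trinomial {n m : ℕ} (hn : Even n) (hmn : m < n)
    (h : Squarefree (X ^ n + X ^ m + 1 : (ZMod 2)[X])) : Odd m := by
  by_contra hodd
  obtain ⟨c, rfl⟩ := Nat.not_odd_iff_even.mp hodd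
  obtain ⟨d, rfl⟩ := hn
  have hu := h (X ^ d + X ^ c + 1) (dvd_of_eq (by
    rw [← sq, CharTwo.add_sq, CharTwo.add_sq]; ring))
  have h0 := natDegree_eq_zero_of_isUnit hu
  rw [natDegree_trinomial (by omega)] at h0
  omega

/-- **Swan (1962).** Let `k ≥ 1` and `0 < m < 8k`.  Then `x^{8k} + x^m + 1 ∈ 𝔽₂[x]`,
whenever it is squarefree, has an even number of irreducible factors (counted with
multiplicity); in particular it is never irreducible. -/
theorem swan_trinomial (k m : ℕ) (hk : 1 ≤ k) (hm : 0 < m) (hmk : m < 8 * k)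
    (f : Polynomial (ZMod 2)) (hf : f = X ^ (8 * k) + X ^ m + 1) :
    (Squarefree f → Even (UniqueFactorizationMonoid.factors f).card) ∧
    ¬ Irreducible f := by
  subst hf
  have even_card (h : Squarefree (X ^ (8 * k) + X ^ m + 1 : (ZMod 2)[X])) :=
    even_card_factors_trinomial hk
      (odd_of_squarefree_trinomial ⟨4 * k, by ring⟩ hmk h) hmk
  refine ⟨even_card, fun h => ?_⟩
  have := even_card h.squarefree
  rw [UniqueFactorizationMonoid.card_factors_of_irreducible h] at this
  exact absurd this (by decide)
end
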